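/- Let L be a finite-dimensional nilpotent Lie superalgebra over a field F (char F ≠ 2,3) with dim L' = (r | s) where r + s = 1, and suppose dim L/Z(L) > 2. Then L is not capable. -/

import Mathlib

/-!
Common definitions: Lie superalgebras over a field `F` (char ≠ 2,3 where needed),
graded ideals, centers, capability, epicenter, non-abelian tensor and exterior
products (characterized by generators-and-relations universal properties),
free Lie superalgebras, Schur multipliers, Heisenberg Lie superalgebras, etc.
-/

namespace SuperLie

open Submodule Function Module

universe u v w

/-- The sign `(-1)^{|a||b|}` attached to a pair of `ℤ₂`-degrees. -/
def sg (F : Type u) [Field F] (a b : ZMod 2) : F := (-1 : F) ^ (a.val * b.val)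

/-- A Lie superalgebra over `F`: a `ℤ₂`-graded vector space `L = L₀ ⊕ L₁`
together with an even bilinear bracket satisfying graded skew-symmetry and the
graded Jacobi identity (on homogeneous elements). -/
class LieSuper (F : Type u) [Field F] (L : Type v) [AddCommGroup L] [Module F L] where
  gr : ZMod 2 → Submodule F L
  isCompl_gr : IsCompl (gr 0) (gr 1)
  br : L → L → L
  br_add_left : ∀ x y z : L, br (x + y) z = br x z + br y z
  br_add_right : ∀ x y z : L, br x (y + z) = br x y + br x z
  br_smul_left : ∀ (c : F) (x y : L), br (c • x) y = c • br x y
  br_smul_right : ∀ (c : F) (x y : L), br x (c • y) = c • br x y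
  br_gr : ∀ a b : ZMod 2, ∀ x ∈ gr a, ∀ y ∈ gr b, br x y ∈ gr (a + b)
  br_skew : ∀ a b : ZMod 2, ∀ x ∈ gr a, ∀ y ∈ gr b, br x y = -(sg F a b) • br y x
  br_jacobi : ∀ a b c : ZMod 2, ∀ x ∈ gr a, ∀ y ∈ gr b, ∀ z ∈ gr c,
    sg F a c • br x (br y z) + sg F b a • br y (br z x) + sg F c b • br z (br x y) = 0

/-- The `a`-graded piece of a Lie superalgebra. -/
def grd (F : Type u) [Field F] (L : Type v) [AddCommGroup L] [Module F L] [LieSuper F L]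
    (a : ZMod 2) : Submodule F L :=
  LieSuper.gr a

/-- The bracket of a Lie superalgebra. -/
def sbr (F : Type u) [Field F] {L : Type v} [AddCommGroup L] [Module F L] [LieSuper F L]
    (x y : L) : L :=
  LieSuper.br (F := F) x y

/-- The center `Z(L) = {z ∈ L : [z,x] = 0 for all x ∈ L}`. -/
def centerS (F : Type u) [Field F] (L : Type v) [AddCommGroup L] [Module F L] [LieSuper F L] :
    Submodule F L where
  carrier := {z : L | ∀ x : L, sbr F z x = 0}
  add_mem' := by
    intro a b ha hb x
    simp only [Set.mem_setOf_eq, sbr] at ha hb ⊢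
    rw [LieSuper.br_add_left, ha x, hb x, add_zero]
  zero_mem' := by
    intro x
    have h := LieSuper.br_smul_left (F := F) (0 : F) (0 : L) x
    simp only [Set.mem_setOf_eq, sbr, zero_smul] at h ⊢
    simpa using h
  smul_mem' := by
    intro c a ha x
    simp only [Set.mem_setOf_eq, sbr] at ha ⊢
    rw [LieSuper.br_smul_left, ha x, smul_zero]

/-- Homomorphisms of Lie superalgebras: even (grading preserving) linear maps
which preserve the bracket. -/
def IsHom (F : Type u) [Field F] {L : Type v} {M : Type w}
    [AddCommGroup L] [Module F L] [LieSuper F L]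
    [AddCommGroup M] [Module F M] [LieSuper F M] (f : L →ₗ[F] M) : Prop :=
  (∀ a : ZMod 2, ∀ x ∈ grd F L a, f x ∈ grd F M a) ∧
  (∀ x y : L, f (sbr F x y) = sbr F (f x) (f y))

/-- A bundled Lie superalgebra over `F`. -/
structure LieSupAlg (F : Type u) [Field F] : Type (max u (v + 1)) where
  carrier : Type v
  [iag : AddCommGroup carrier]
  [imo : Module F carrier]
  [ils : LieSuper F carrier]

attribute [instance] LieSupAlg.iag LieSupAlg.imo LieSupAlg.ils

instance (F : Type u) [Field F] : CoeSort (LieSupAlg.{u, v} F) (Type v) :=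
  ⟨LieSupAlg.carrier⟩

/-- A Lie superalgebra `L` is capable if `L ≅ H/Z(H)` for some Lie superalgebra `H`,
i.e. there is a surjective homomorphism onto `L` whose kernel is exactly the center. -/
def Capable (F : Type u) [Field F] (L : Type v) [AddCommGroup L] [Module F L]
    [LieSuper F L] : Prop :=
  ∃ (H : LieSupAlg.{u, max u v} F) (φ : H.carrier →ₗ[F] L),
    IsHom F φ ∧ Surjective φ ∧ LinearMap.ker φ = centerS F H.carrier

/-- Graded ideals of a Lie superalgebra. -/
def IsGIdeal (F : Type u) [Field F] {L : Type v} [AddCommGroup L] [Module F L]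
    [LieSuper F L] (I : Submodule F L) : Prop :=
  (∀ x ∈ I, ∀ y : L, sbr F x y ∈ I) ∧ (∀ y : L, ∀ x ∈ I, sbr F y x ∈ I) ∧
  (∀ x ∈ I, ∃ x0 ∈ I ⊓ grd F L 0, ∃ x1 ∈ I ⊓ grd F L 1, x = x0 + x1)

/-- The graded ideal generated by a subset. -/
def idealClosure (F : Type u) [Field F] {L : Type v} [AddCommGroup L] [Module F L]
    [LieSuper F L] (S : Set L) : Submodule F L :=
  sInf {I : Submodule F L | IsGIdeal F I ∧ S ⊆ ↑I}

/-- `QuotCapable F L N` expresses that the quotient Lie superalgebra `L/N` is capable. -/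
def QuotCapable (F : Type u) [Field F] (L : Type v) [AddCommGroup L] [Module F L]
    [LieSuper F L] (N : Submodule F L) : Prop :=
  ∃ (Q : LieSupAlg.{u, max u v} F) (π : L →ₗ[F] Q.carrier),
    IsHom F π ∧ Surjective π ∧ LinearMap.ker π = N ∧ Capable F Q.carrier

/-- The epicenter `Z^*(L)`: the smallest graded ideal of `L` such that the
corresponding quotient is capable. -/
def IsEpicenter (F : Type u) [Field F] (L : Type v) [AddCommGroup L] [Module F L]
    [LieSuper F L] (Z : Submodule F L) : Prop :=
  IsGIdeal F Z ∧ QuotCapable F L Z ∧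
  ∀ N : Submodule F L, IsGIdeal F N → QuotCapable F L N → Z ≤ N

/-- The submodule `[I,J]` spanned by brackets. -/
def bracketSpan (F : Type u) [Field F] {L : Type v} [AddCommGroup L] [Module F L]
    [LieSuper F L] (I J : Submodule F L) : Submodule F L :=
  Submodule.span F {z : L | ∃ x ∈ I, ∃ y ∈ J, z = sbr F x y}

/-- The derived subalgebra `L' = [L,L]`. -/
def derived (F : Type u) [Field F] (L : Type v) [AddCommGroup L] [Module F L]
    [LieSuper F L] : Submodule F L :=
  bracketSpan F (⊤ : Submodule F L) ⊤

/-- The lower central series of a Lie superalgebra. -/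
def lowerCentral (F : Type u) [Field F] (L : Type v) [AddCommGroup L] [Module F L]
    [LieSuper F L] : ℕ → Submodule F L
  | 0 => ⊤
  | n + 1 => bracketSpan F (lowerCentral F L n) ⊤

/-- A Lie superalgebra is nilpotent if its lower central series terminates at zero. -/
def IsNilp (F : Type u) [Field F] (L : Type v) [AddCommGroup L] [Module F L]
    [LieSuper F L] : Prop :=
  ∃ n : ℕ, lowerCentral F L n = ⊥

/-- An action of a Lie superalgebra `P` on a Lie superalgebra `M`:
an even bilinear map satisfying the two action axioms. -/
structure IsAction (F : Type u) [Field F] {P : Type v} {M : Type v}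
    [AddCommGroup P] [Module F P] [LieSuper F P]
    [AddCommGroup M] [Module F M] [LieSuper F M] (act : P → M → M) : Prop where
  add_left : ∀ (p q : P) (m : M), act (p + q) m = act p m + act q m
  add_right : ∀ (p : P) (m m' : M), act p (m + m') = act p m + act p m'
  smul_left : ∀ (c : F) (p : P) (m : M), act (c • p) m = c • act p m
  smul_right : ∀ (c : F) (p : P) (m : M), act p (c • m) = c • act p m
  grade : ∀ a b : ZMod 2, ∀ p ∈ grd F P a, ∀ m ∈ grd F M b, act p m ∈ grd F M (a + b)
  br_act : ∀ a b : ZMod 2, ∀ p ∈ grd F P a, ∀ p' ∈ grd F P b, ∀ m : M,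
    act (sbr F p p') m = act p (act p' m) - sg F a b • act p' (act p m)
  act_br : ∀ a b : ZMod 2, ∀ p ∈ grd F P a, ∀ m ∈ grd F M b, ∀ m' : M,
    act p (sbr F m m') = sbr F (act p m) m' + sg F a b • sbr F m (act p m')

/-- Compatibility of mutual actions of two Lie superalgebras on each other. -/
def Compatible (F : Type u) [Field F] {M : Type v} {N : Type v}
    [AddCommGroup M] [Module F M] [LieSuper F M]
    [AddCommGroup N] [Module F N] [LieSuper F N]
    (actMN : M → N → N) (actNM : N → M → M) : Prop :=
  (∀ a b : ZMod 2, ∀ m ∈ grd F M a, ∀ n ∈ grd F N b, ∀ n' : N,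
      actMN (actNM n m) n' = -(sg F a b) • sbr F (actMN m n) n') ∧
  (∀ a b : ZMod 2, ∀ m ∈ grd F M a, ∀ n ∈ grd F N b, ∀ m' : M,
      actNM (actMN m n) m' = -(sg F a b) • sbr F (actNM n m) m')

/-- The defining relations of the non-abelian tensor product `M ⊗ N` of Lie
superalgebras (with given mutual actions), satisfied by a pairing `q` into `T`. -/
structure TensorRel (F : Type u) [Field F] {M : Type v} {N : Type v} {T : Type w}
    [AddCommGroup M] [Module F M] [LieSuper F M]
    [AddCommGroup N] [Module F N] [LieSuper F N]
    [AddCommGroup T] [Module F T] [LieSuper F T]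
    (actMN : M → N → N) (actNM : N → M → M) (q : M → N → T) : Prop where
  add_left : ∀ (m m' : M) (n : N), q (m + m') n = q m n + q m' n
  add_right : ∀ (m : M) (n n' : N), q m (n + n') = q m n + q m n'
  smul_left : ∀ (c : F) (m : M) (n : N), q (c • m) n = c • q m n
  smul_right : ∀ (c : F) (m : M) (n : N), q m (c • n) = c • q m n
  grade : ∀ a b : ZMod 2, ∀ m ∈ grd F M a, ∀ n ∈ grd F N b, q m n ∈ grd F T (a + b)
  brk_left : ∀ a b : ZMod 2, ∀ m ∈ grd F M a, ∀ m' ∈ grd F M b, ∀ n : N,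
    q (sbr F m m') n = q m (actMN m' n) - sg F a b • q m' (actMN m n)
  brk_right : ∀ a b c : ZMod 2, ∀ m ∈ grd F M a, ∀ n ∈ grd F N b, ∀ n' ∈ grd F N c,
    q m (sbr F n n') = sg F c (a + b) • q (actNM n' m) n - sg F a b • q (actNM n m) n'
  brk_brk : ∀ a b : ZMod 2, ∀ m ∈ grd F M a, ∀ n ∈ grd F N b, ∀ (m' : M) (n' : N),
    sbr F (q m n) (q m' n') = -(sg F a b) • q (actNM n m) (actMN m' n')

/-- `IsTensorObj F actMN actNM t` says that `(T, t)` is the non-abelian tensor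
product `M ⊗ N`: the pairing `t` satisfies the defining relations and is
universal among all pairings satisfying them. -/
structure IsTensorObj (F : Type u) [Field F] {M : Type v} {N : Type v} {T : Type v}
    [AddCommGroup M] [Module F M] [LieSuper F M]
    [AddCommGroup N] [Module F N] [LieSuper F N]
    [AddCommGroup T] [Module F T] [LieSuper F T]
    (actMN : M → N → N) (actNM : N → M → M) (t : M → N → T) : Prop where
  rel : TensorRel F actMN actNM t
  lift : ∀ (Q : LieSupAlg.{u, max u v} F) (q : M → N → Q.carrier),
    TensorRel F actMN actNM q →
    ∃! h : T →ₗ[F] Q.carrier, IsHom F h ∧ ∀ (m : M) (n : N), h (t m n) = q m n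

/-- The defining relations of the non-abelian exterior square `L ∧ L` of a Lie
superalgebra (the tensor relations for the bracket actions, together with the
graded alternating relations coming from `L □ L`). -/
structure ExtRel (F : Type u) [Field F] {L : Type v} {T : Type w}
    [AddCommGroup L] [Module F L] [LieSuper F L]
    [AddCommGroup T] [Module F T] [LieSuper F T] (q : L → L → T) : Prop where
  toTensor : TensorRel F (fun x y : L => sbr F x y) (fun x y : L => sbr F x y) q
  alt : ∀ a b : ZMod 2, ∀ x ∈ grd F L a, ∀ y ∈ grd F L b, q x y = -(sg F a b) • q y x
  alt_even : ∀ x ∈ grd F L 0, q x x = 0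

/-- `IsExtObj F t` says that `(E, t)` is the non-abelian exterior square `L ∧ L`. -/
structure IsExtObj (F : Type u) [Field F] {L : Type v} {E : Type v}
    [AddCommGroup L] [Module F L] [LieSuper F L]
    [AddCommGroup E] [Module F E] [LieSuper F E] (t : L → L → E) : Prop where
  rel : ExtRel F t
  lift : ∀ (Q : LieSupAlg.{u, max u v} F) (q : L → L → Q.carrier),
    ExtRel F q →
    ∃! h : E →ₗ[F] Q.carrier, IsHom F h ∧ ∀ x y : L, h (t x y) = q x y

/-- A free Lie superalgebra: free on some `ℤ₂`-graded subset `X`. -/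
def IsFreeLieSuper (F : Type u) [Field F] (Fr : Type v) [AddCommGroup Fr] [Module F Fr]
    [LieSuper F Fr] : Prop :=
  ∃ X : ZMod 2 → Set Fr,
    (∀ a : ZMod 2, X a ⊆ (grd F Fr a : Set Fr)) ∧
    ∀ (Q : LieSupAlg.{u, max u v} F) (f : ∀ a : ZMod 2, X a → Q.carrier),
      (∀ (a : ZMod 2) (x : X a), f a x ∈ grd F Q.carrier a) →
      ∃! h : Fr →ₗ[F] Q.carrier,
        IsHom F h ∧ ∀ (a : ZMod 2) (x : X a), h (x : Fr) = f a x

/-- `F' ∩ R`, for a free presentation with kernel `R`. -/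
abbrev schurA (F : Type u) [Field F] (Fr : Type v) [AddCommGroup Fr] [Module F Fr]
    [LieSuper F Fr] (R : Submodule F Fr) : Submodule F Fr :=
  derived F Fr ⊓ R

/-- The Schur multiplier `M(L) = (F' ∩ R)/[R,F]` attached to a free presentation
`0 → R → F → L → 0`. -/
abbrev SchurMul (F : Type u) [Field F] (Fr : Type v) [AddCommGroup Fr] [Module F Fr]
    [LieSuper F Fr] (R : Submodule F Fr) :=
  ↥(schurA F Fr R) ⧸ (Submodule.comap (schurA F Fr R).subtype (bracketSpan F R ⊤))

/-- `L` is (isomorphic to) the special Heisenberg Lie superalgebra `H(m,n)` with even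
center: basis `x₁,…,x_{2m}, z` (even), `y₁,…,y_n` (odd), with `[xᵢ, x_{m+i}] = z`,
`[y_j, y_j] = z` and `z` central. -/
def IsHeisE (F : Type u) [Field F] (m n : ℕ) (L : Type v) [AddCommGroup L] [Module F L]
    [LieSuper F L] : Prop :=
  ∃ (x : Fin (2 * m) → L) (y : Fin n → L) (z : L),
    (∀ i, x i ∈ grd F L 0) ∧ z ∈ grd F L 0 ∧ (∀ j, y j ∈ grd F L 1) ∧
    LinearIndependent F (Sum.elim x (Sum.elim y (fun _ : Unit => z))) ∧
    Submodule.span F (Set.range (Sum.elim x (Sum.elim y (fun _ : Unit => z)))) = ⊤ ∧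
    (∀ i j : Fin (2 * m), sbr F (x i) (x j) =
      if (j : ℕ) = (i : ℕ) + m then z else if (i : ℕ) = (j : ℕ) + m then -z else 0) ∧
    (∀ (i : Fin (2 * m)) (j : Fin n), sbr F (x i) (y j) = 0) ∧
    (∀ (i : Fin (2 * m)) (j : Fin n), sbr F (y j) (x i) = 0) ∧
    (∀ i j : Fin n, sbr F (y i) (y j) = if i = j then z else 0) ∧
    (∀ w : L, sbr F z w = 0) ∧ (∀ w : L, sbr F w z = 0)

/-- `L` is (isomorphic to) the Heisenberg Lie superalgebra `H_m` with odd center: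
basis `x₁,…,x_m` (even), `y₁,…,y_m, z` (odd), with `[x_j, y_j] = z` and `z` central. -/
def IsHeisO (F : Type u) [Field F] (m : ℕ) (L : Type v) [AddCommGroup L] [Module F L]
    [LieSuper F L] : Prop :=
  ∃ (x : Fin m → L) (y : Fin m → L) (z : L),
    (∀ i, x i ∈ grd F L 0) ∧ (∀ j, y j ∈ grd F L 1) ∧ z ∈ grd F L 1 ∧
    LinearIndependent F (Sum.elim x (Sum.elim y (fun _ : Unit => z))) ∧
    Submodule.span F (Set.range (Sum.elim x (Sum.elim y (fun _ : Unit => z)))) = ⊤ ∧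
    (∀ i j : Fin m, sbr F (x i) (x j) = 0) ∧
    (∀ i j : Fin m, sbr F (x i) (y j) = if i = j then z else 0) ∧
    (∀ i j : Fin m, sbr F (y j) (x i) = if i = j then -z else 0) ∧
    (∀ i j : Fin m, sbr F (y i) (y j) = 0) ∧
    (∀ w : L, sbr F z w = 0) ∧ (∀ w : L, sbr F w z = 0)

/-- `A` is (isomorphic to) the abelian Lie superalgebra `A(r | s)` of
superdimension `(r | s)`. -/
def IsAbelSuper (F : Type u) [Field F] (r s : ℕ) (A : Type v) [AddCommGroup A]
    [Module F A] [LieSuper F A] : Prop :=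
  (∀ x y : A, sbr F x y = 0) ∧ Module.Finite F A ∧
  Module.finrank F ↥(grd F A 0) = r ∧ Module.finrank F ↥(grd F A 1) = s

/-- The direct sum (product) of two Lie superalgebras. -/
instance prodLieSuper (F : Type u) [Field F] (A : Type v) (B : Type w)
    [AddCommGroup A] [Module F A] [LieSuper F A]
    [AddCommGroup B] [Module F B] [LieSuper F B] : LieSuper F (A × B) where
  gr a := (grd F A a).prod (grd F B a)
  isCompl_gr := by
    have hA : IsCompl (grd F A 0) (grd F A 1) := LieSuper.isCompl_gr
    have hB : IsCompl (grd F B 0) (grd F B 1) := LieSuper.isCompl_gr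
    constructor
    · rw [disjoint_iff, eq_bot_iff]
      rintro ⟨a, b⟩ h
      rw [Submodule.mem_inf] at h
      obtain ⟨h0, h1⟩ := h
      rw [Submodule.mem_prod] at h0 h1
      have ha : a = 0 := by
        have := hA.disjoint.le_bot (Submodule.mem_inf.mpr ⟨h0.1, h1.1⟩)
        simpa using this
      have hb : b = 0 := by
        have := hB.disjoint.le_bot (Submodule.mem_inf.mpr ⟨h0.2, h1.2⟩)
        simpa using this
      simp [ha, hb, Prod.ext_iff]
    · rw [codisjoint_iff, eq_top_iff]
      rintro ⟨a, b⟩ -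
      have ha' : a ∈ grd F A 0 ⊔ grd F A 1 := by
        rw [hA.codisjoint.eq_top]; trivial
      have hb' : b ∈ grd F B 0 ⊔ grd F B 1 := by
        rw [hB.codisjoint.eq_top]; trivial
      obtain ⟨a0, ha0, a1, ha1, rfl⟩ := Submodule.mem_sup.mp ha'
      obtain ⟨b0, hb0, b1, hb1, rfl⟩ := Submodule.mem_sup.mp hb'
      refine Submodule.mem_sup.mpr ⟨(a0, b0), ?_, (a1, b1), ?_, ?_⟩
      · exact Submodule.mem_prod.mpr ⟨ha0, hb0⟩
      · exact Submodule.mem_prod.mpr ⟨ha1, hb1⟩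
      · rfl
  br x y := (sbr F x.1 y.1, sbr F x.2 y.2)
  br_add_left := by
    intro x y z
    simp only [Prod.fst_add, Prod.snd_add, sbr, LieSuper.br_add_left]
    rfl
  br_add_right := by
    intro x y z
    simp only [Prod.fst_add, Prod.snd_add, sbr, LieSuper.br_add_right]
    rfl
  br_smul_left := by
    intro c x y
    simp only [Prod.smul_fst, Prod.smul_snd, sbr, LieSuper.br_smul_left]
    rfl
  br_smul_right := by
    intro c x y
    simp only [Prod.smul_fst, Prod.smul_snd, sbr, LieSuper.br_smul_right]
    rfl
  br_gr := by
    intro a b x hx y hy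
    rw [Submodule.mem_prod] at hx hy ⊢
    exact ⟨LieSuper.br_gr a b x.1 hx.1 y.1 hy.1, LieSuper.br_gr a b x.2 hx.2 y.2 hy.2⟩
  br_skew := by
    intro a b x hx y hy
    rw [Submodule.mem_prod] at hx hy
    have h1 := LieSuper.br_skew (F := F) a b x.1 hx.1 y.1 hy.1
    have h2 := LieSuper.br_skew (F := F) a b x.2 hx.2 y.2 hy.2
    simp only [sbr]
    rw [Prod.ext_iff]
    exact ⟨h1, h2⟩
  br_jacobi := by
    intro a b c x hx y hy z hz
    rw [Submodule.mem_prod] at hx hy hz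
    have h1 := LieSuper.br_jacobi (F := F) a b c x.1 hx.1 y.1 hy.1 z.1 hz.1
    have h2 := LieSuper.br_jacobi (F := F) a b c x.2 hx.2 y.2 hy.2 z.2 hz.2
    simp only [sbr]
    rw [Prod.ext_iff]
    exact ⟨h1, h2⟩

section Aux

variable {F : Type u} [Field F] {L : Type v} [AddCommGroup L] [Module F L] [LieSuper F L]

theorem aux_add_left (x y z : L) : sbr F (x + y) z = sbr F x z + sbr F y z :=
  LieSuper.br_add_left x y z

theorem aux_add_right (x y z : L) : sbr F x (y + z) = sbr F x y + sbr F x z :=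
  LieSuper.br_add_right x y z

theorem aux_smul_left (c : F) (x y : L) : sbr F (c • x) y = c • sbr F x y :=
  LieSuper.br_smul_left c x y

theorem aux_smul_right (c : F) (x y : L) : sbr F x (c • y) = c • sbr F x y :=
  LieSuper.br_smul_right c x y

theorem aux_zero_right (x : L) : sbr F x (0 : L) = 0 := by
  have := aux_smul_right (0 : F) x (0 : L)
  simpa using this

theorem aux_gr {a b : ZMod 2} {x y : L} (hx : x ∈ grd F L a) (hy : y ∈ grd F L b) :
    sbr F x y ∈ grd F L (a + b) := LieSuper.br_gr a b x hx y hy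

theorem aux_sg_ne (a b : ZMod 2) : sg F a b ≠ 0 := by
  unfold sg
  exact pow_ne_zero _ (neg_ne_zero.mpr one_ne_zero)

theorem aux_skew_zero {a b : ZMod 2} {x y : L} (hx : x ∈ grd F L a) (hy : y ∈ grd F L b)
    (h : sbr F x y = 0) : sbr F y x = 0 := by
  have := LieSuper.br_skew (F := F) b a y hy x hx
  change sbr F y x = -(sg F b a) • sbr F x y at this
  rw [this, h, smul_zero]

theorem aux_split (x : L) : ∃ x0 ∈ grd F L 0, ∃ x1 ∈ grd F L 1, x = x0 + x1 := by
  have hA : IsCompl (grd F L 0) (grd F L 1) := LieSuper.isCompl_gr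
  have h : x ∈ grd F L 0 ⊔ grd F L 1 := by rw [hA.codisjoint.eq_top]; trivial
  obtain ⟨a, ha, b, hb, e⟩ := Submodule.mem_sup.mp h
  exact ⟨a, ha, b, hb, e.symm⟩

theorem aux_sum_zero01 {x y : L} (hx : x ∈ grd F L 0) (hy : y ∈ grd F L 1)
    (h : x + y = 0) : x = 0 ∧ y = 0 := by
  have hA : IsCompl (grd F L 0) (grd F L 1) := LieSuper.isCompl_gr
  have e : x = -y := eq_neg_of_add_eq_zero_left h
  have hx1 : x ∈ grd F L 1 := by rw [e]; exact (grd F L 1).neg_mem hy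
  have hx0 : x = 0 := by
    simpa using hA.disjoint.le_bot (Submodule.mem_inf.mpr ⟨hx, hx1⟩)
  refine ⟨hx0, ?_⟩
  rw [hx0, zero_add] at h
  exact h

theorem aux_sum_zero (a : ZMod 2) {x y : L} (hx : x ∈ grd F L a) (hy : y ∈ grd F L (a + 1))
    (h : x + y = 0) : x = 0 ∧ y = 0 := by
  fin_cases a
  · exact aux_sum_zero01 hx hy h
  · exact (aux_sum_zero01 (x := y) (y := x) hy hx (by rw [add_comm]; exact h)).symm

theorem aux_split' (a : ZMod 2) (x : L) :
    ∃ x0 ∈ grd F L a, ∃ x1 ∈ grd F L (a + 1), x = x0 + x1 := by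
  fin_cases a
  · exact aux_split x
  · obtain ⟨p, hp, q, hq, e⟩ := aux_split (F := F) x
    exact ⟨q, hq, p, hp, by rw [e, add_comm]⟩

theorem aux_mem_derived (x y : L) : sbr F x y ∈ derived F L :=
  Submodule.subset_span ⟨x, trivial, y, trivial, rfl⟩

theorem aux_derived_le :
    derived F L ≤ (derived F L ⊓ grd F L 0) ⊔ (derived F L ⊓ grd F L 1) := by
  have key : ∀ a : ZMod 2, derived F L ⊓ grd F L a ≤
      (derived F L ⊓ grd F L 0) ⊔ (derived F L ⊓ grd F L 1) := by
    intro a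
    fin_cases a
    · exact le_sup_left
    · exact le_sup_right
  refine Submodule.span_le.mpr ?_
  rintro _ ⟨x, -, y, -, rfl⟩
  obtain ⟨x0, hx0, x1, hx1, rfl⟩ := aux_split (F := F) x
  obtain ⟨y0, hy0, y1, hy1, rfl⟩ := aux_split (F := F) y
  have t : ∀ {a b : ZMod 2} {x y : L}, x ∈ grd F L a → y ∈ grd F L b →
      sbr F x y ∈ (derived F L ⊓ grd F L 0) ⊔ (derived F L ⊓ grd F L 1) :=
    fun hx hy => key _ ⟨aux_mem_derived _ _, aux_gr hx hy⟩
  rw [aux_add_left, aux_add_right, aux_add_right]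
  exact add_mem (add_mem (t hx0 hy0) (t hx0 hy1)) (add_mem (t hx1 hy0) (t hx1 hy1))

/-- Main dimension argument. -/
theorem aux_pair [FiniteDimensional F L] (hD : finrank F (derived F L) ≤ 1)
    (hbig : 2 < finrank F (L ⧸ centerS F L)) (w : L) :
    ∃ x y : L, sbr F w x = 0 ∧ sbr F w y = 0 ∧ sbr F x y ≠ 0 := by
  by_contra hcon
  push Not at hcon
  have hv : ∃ u : L, ∀ y : L, ∃ c : F, sbr F w (y - c • u) = 0 := by
    by_cases hu : ∃ u, sbr F w u ≠ 0
    · obtain ⟨u, hu⟩ := hu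
      refine ⟨u, fun y => ?_⟩
      obtain ⟨v, hv⟩ := finrank_le_one_iff.mp hD
      obtain ⟨c, hc⟩ := hv ⟨sbr F w u, aux_mem_derived _ _⟩
      obtain ⟨d, hd⟩ := hv ⟨sbr F w y, aux_mem_derived _ _⟩
      have hc' : c • (v : L) = sbr F w u := congrArg Subtype.val hc
      have hd' : d • (v : L) = sbr F w y := congrArg Subtype.val hd
      have hc0 : c ≠ 0 := by
        rintro rfl
        apply hu
        rw [← hc', zero_smul]
      refine ⟨d / c, ?_⟩
      rw [sub_eq_add_neg, ← neg_smul, aux_add_right, aux_smul_right, ← hc', ← hd', smul_smul,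
        ← add_smul]
      have : d + -(d / c) * c = 0 := by field_simp; ring
      rw [this, zero_smul]
    · push Not at hu
      exact ⟨0, fun y => ⟨0, hu _⟩⟩
  obtain ⟨u, hu⟩ := hv
  let T1 : L →ₗ[F] derived F L :=
    { toFun := fun x => ⟨sbr F w x, aux_mem_derived _ _⟩
      map_add' := fun x y => Subtype.ext (aux_add_right _ _ _)
      map_smul' := fun c x => Subtype.ext (aux_smul_right _ _ _) }
  let T2 : L →ₗ[F] derived F L :=
    { toFun := fun x => ⟨sbr F x u, aux_mem_derived _ _⟩
      map_add' := fun x y => Subtype.ext (aux_add_left _ _ _)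
      map_smul' := fun c x => Subtype.ext (aux_smul_left _ _ _) }
  let T := T1.prod T2
  have hker : LinearMap.ker T ≤ centerS F L := by
    intro x hx y
    have h := LinearMap.mem_ker.mp hx
    have h1 : sbr F w x = 0 := congrArg (fun p => (p.1 : L)) h
    have h2 : sbr F x u = 0 := congrArg (fun p => (p.2 : L)) h
    obtain ⟨c, hc⟩ := hu y
    have h3 := hcon x _ h1 hc
    have : y = (y - c • u) + c • u := by abel
    rw [this, aux_add_right, h3, aux_smul_right, h2, smul_zero, add_zero]
  have e1 := LinearMap.finrank_range_add_finrank_ker T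
  have e2 := Submodule.finrank_quotient_add_finrank (centerS F L)
  have e3 := Submodule.finrank_mono hker
  have e4 := Submodule.finrank_le (LinearMap.range T)
  rw [Module.finrank_prod] at e4
  omega

theorem aux_pair_hom [FiniteDimensional F L] (hD : finrank F (derived F L) ≤ 1)
    (hbig : 2 < finrank F (L ⧸ centerS F L)) {c : ZMod 2} {w : L} (hw : w ∈ grd F L c) :
    ∃ (a b : ZMod 2) (x y : L), x ∈ grd F L a ∧ y ∈ grd F L b ∧
      sbr F w x = 0 ∧ sbr F w y = 0 ∧ sbr F x y ≠ 0 := by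
  obtain ⟨x, y, hx, hy, hxy⟩ := aux_pair hD hbig w
  obtain ⟨x0, hx0, x1, hx1, rfl⟩ := aux_split (F := F) x
  obtain ⟨y0, hy0, y1, hy1, rfl⟩ := aux_split (F := F) y
  have t : ∀ {p q : L}, p ∈ grd F L 0 → q ∈ grd F L 1 → sbr F w (p + q) = 0 →
      sbr F w p = 0 ∧ sbr F w q = 0 := by
    intro p q hp hq h
    rw [aux_add_right] at h
    have h0 := aux_gr hw hp
    rw [add_zero] at h0
    exact aux_sum_zero c h0 (aux_gr hw hq) h
  obtain ⟨a0, a1⟩ := t hx0 hx1 hx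
  obtain ⟨b0, b1⟩ := t hy0 hy1 hy
  by_contra hcon
  push Not at hcon
  apply hxy
  rw [aux_add_left, aux_add_right, aux_add_right, hcon _ _ _ _ hx0 hy0 a0 b0,
    hcon _ _ _ _ hx0 hy1 a0 b1, hcon _ _ _ _ hx1 hy0 a1 b0, hcon _ _ _ _ hx1 hy1 a1 b1]
  simp

theorem aux_lift {H : Type w} [AddCommGroup H] [Module F H] [LieSuper F H] {φ : H →ₗ[F] L}
    (hφ : IsHom F φ) (hs : Surjective φ) {a : ZMod 2} {x : L} (hx : x ∈ grd F L a) :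
    ∃ h ∈ grd F H a, φ h = x := by
  obtain ⟨h, rfl⟩ := hs x
  obtain ⟨p, hp, q, hq, rfl⟩ := aux_split' (F := F) a h
  have h1 := hφ.1 _ _ hp
  have h2 := hφ.1 _ _ hq
  have h3 : φ q ∈ grd F L a := by
    have : φ q = φ (p + q) - φ p := by rw [map_add]; abel
    rw [this]
    exact sub_mem hx h1
  have := (aux_sum_zero a (x := φ q) (y := -φ q) h3 (neg_mem h2) (by simp)).1
  exact ⟨p, hp, by rw [map_add, this, add_zero]⟩

end Aux

/-- a finite-dimensional nilpotent Lie superalgebra `L` with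
`dim L' = (r | s)`, `r + s = 1`, and `dim L/Z(L) > 2` is not capable. -/
theorem not_capable_of_dim_central_quotient_gt_two (F : Type u) [Field F]
    (hchar2 : (2 : F) ≠ 0) (hchar3 : (3 : F) ≠ 0)
    (r s : ℕ)
    (L : Type v) [AddCommGroup L] [Module F L] [LieSuper F L]
    [FiniteDimensional F L] (hnilp : IsNilp F L)
    (hr : Module.finrank F ↥(derived F L ⊓ grd F L 0) = r)
    (hs : Module.finrank F ↥(derived F L ⊓ grd F L 1) = s)
    (hrs : r + s = 1)
    (hbig : 2 < Module.finrank F (L ⧸ centerS F L)) :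
    ¬ Capable F L := by
  rintro ⟨H, φ, hφ, hsurj, hker⟩
  have hD : finrank F (derived F L) ≤ 1 := by
    have h1 := Submodule.finrank_mono (aux_derived_le (F := F) (L := L))
    have h2 := Submodule.finrank_add_le_finrank_add_finrank
      (derived F L ⊓ grd F L 0) (derived F L ⊓ grd F L 1)
    omega
  obtain ⟨v, hv⟩ := finrank_le_one_iff.mp hD
  obtain ⟨zh, hzh⟩ := hsurj (v : L)
  have hkc : ∀ h : H.carrier, φ h = 0 → ∀ k, sbr F h k = 0 := by
    intro h hh
    have : h ∈ centerS F H.carrier := by rw [← hker]; exact hh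
    exact this
  have main : ∀ (c : ZMod 2) (k : H.carrier), k ∈ grd F H.carrier c → sbr F zh k = 0 := by
    intro c k hk
    obtain ⟨a, b, x, y, hx, hy, hwx, hwy, hxy⟩ := aux_pair_hom hD hbig (hφ.1 c k hk)
    obtain ⟨p, hp, rfl⟩ := aux_lift hφ hsurj hx
    obtain ⟨q, hq, rfl⟩ := aux_lift hφ hsurj hy
    have hyw := aux_skew_zero (hφ.1 c k hk) hy hwy
    rw [← hφ.2] at hyw hwx
    have j := LieSuper.br_jacobi (F := F) a b c p hp q hq k hk
    change sg F a c • sbr F p (sbr F q k) + sg F b a • sbr F q (sbr F k p)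
      + sg F c b • sbr F k (sbr F p q) = 0 at j
    rw [aux_skew_zero (aux_gr hq hk) hp (hkc _ hyw p),
      aux_skew_zero (aux_gr hk hp) hq (hkc _ hwx q), smul_zero, smul_zero, zero_add, zero_add] at j
    have j2 := (smul_eq_zero.mp j).resolve_left (aux_sg_ne c b)
    have j3 := aux_skew_zero hk (aux_gr hp hq) j2
    obtain ⟨d, hd⟩ := hv ⟨sbr F (φ p) (φ q), aux_mem_derived _ _⟩
    have hd' : d • (v : L) = sbr F (φ p) (φ q) := congrArg Subtype.val hd
    have hd0 : d ≠ 0 := by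
      rintro rfl
      apply hxy
      rw [← hd', zero_smul]
    have e : φ (sbr F p q + (-d) • zh) = 0 := by
      rw [map_add, map_smul, hφ.2, hzh, ← hd', neg_smul, add_neg_cancel]
    have e2 := hkc _ e k
    rw [aux_add_left, j3, zero_add, aux_smul_left] at e2
    exact (smul_eq_zero.mp e2).resolve_left (neg_ne_zero.mpr hd0)
  have hz : zh ∈ centerS F H.carrier := by
    intro k
    obtain ⟨k0, hk0, k1, hk1, rfl⟩ := aux_split (F := F) k
    rw [aux_add_right, main 0 k0 hk0, main 1 k1 hk1, add_zero]
  rw [← hker] at hz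
  have hv0 : (v : L) = 0 := by rw [← hzh]; exact hz
  obtain ⟨x, y, -, -, hxy⟩ := aux_pair hD hbig (0 : L)
  obtain ⟨d, hd⟩ := hv ⟨sbr F x y, aux_mem_derived _ _⟩
  have hd' : d • (v : L) = sbr F x y := congrArg Subtype.val hd
  apply hxy
  rw [← hd', hv0, smul_zero]

end SuperLie
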